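/- arXiv:1806.06082 — 2 statements merged into one kernel-verified Lean document; each statement's English description precedes it below -/
import Mathlib

section
/- The Chu category Chu(C,Ω) admits a symmetric monoidal structure whose tensor product on objects is A ⊠ B (with (A ⊠ B)⁺ = A⁺ ⊗ B⁺ and (A ⊠ B)⁻ the pullback of [A⁺,B⁻] ⟶ [A⁺ ⊗ B⁺, Ω] ⟵ [B⁺,A⁻]) and whose unit object is (I, Ω, λ), where I is the monoidal unit of C and λ : I ⊗ Ω ⟶ Ω is the left unitor. -/
open CategoryTheory MonoidalCategory Limits

universe v u

variable (C : Type u) [Category.{v} C] [MonoidalCategory C] [SymmetricCategory C] (Ω : C)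

/-- An object of the Chu construction `Chu(C, Ω)`: a pair of objects of `C`
together with a pairing into `Ω`. -/
structure Chu : Type (max u v) where
  pos : C
  neg : C
  pair : pos ⊗ neg ⟶ Ω

variable {C Ω}

/-- A morphism of the Chu construction. -/
@[ext]
structure ChuHom (A B : Chu C Ω) : Type v where
  pos : A.pos ⟶ B.pos
  neg : B.neg ⟶ A.neg
  compat : A.pos ◁ neg ≫ A.pair = pos ▷ B.neg ≫ B.pair

instance : Category (Chu C Ω) where
  Hom := ChuHom
  id A :=
    { pos := 𝟙 A.pos
      neg := 𝟙 A.neg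
      compat := by simp }
  comp {A B E} f g :=
    { pos := f.pos ≫ g.pos
      neg := g.neg ≫ f.neg
      compat := by
        calc A.pos ◁ (g.neg ≫ f.neg) ≫ A.pair
            = A.pos ◁ g.neg ≫ (A.pos ◁ f.neg ≫ A.pair) := by
              rw [MonoidalCategory.whiskerLeft_comp, Category.assoc]
          _ = A.pos ◁ g.neg ≫ (f.pos ▷ B.neg ≫ B.pair) := by rw [f.compat]
          _ = (A.pos ◁ g.neg ≫ f.pos ▷ B.neg) ≫ B.pair := by rw [Category.assoc]
          _ = (f.pos ▷ E.neg ≫ B.pos ◁ g.neg) ≫ B.pair := by rw [whisker_exchange]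
          _ = f.pos ▷ E.neg ≫ (g.pos ▷ E.neg ≫ E.pair) := by
              rw [Category.assoc, g.compat]
          _ = (f.pos ≫ g.pos) ▷ E.neg ≫ E.pair := by
              rw [MonoidalCategory.comp_whiskerRight, Category.assoc] }
  id_comp f := by apply ChuHom.ext <;> simp
  comp_id f := by apply ChuHom.ext <;> simp
  assoc f g h := by apply ChuHom.ext <;> simp

variable [MonoidalClosed C] [Limits.HasPullbacks C]

/-- The leg `[A⁺, B⁻] ⟶ [A⁺ ⊗ B⁺, Ω]`: the transpose of the composite
`[A⁺,B⁻] ⊗ A⁺ ⊗ B⁺ ⟶ B⁻ ⊗ B⁺ ⟶ Ω` (evaluation followed by `e_B`, modulo symmetry). -/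
noncomputable def chuTensorLegB (A B : Chu C Ω) :
    (ihom A.pos).obj B.neg ⟶ (ihom (A.pos ⊗ B.pos)).obj Ω :=
  MonoidalClosed.curry
    ((α_ A.pos B.pos ((ihom A.pos).obj B.neg)).hom ≫
      A.pos ◁ (β_ B.pos ((ihom A.pos).obj B.neg)).hom ≫
      (α_ A.pos ((ihom A.pos).obj B.neg) B.pos).inv ≫
      ((ihom.ev A.pos).app B.neg) ▷ B.pos ≫
      (β_ B.neg B.pos).hom ≫ B.pair)

/-- The leg `[B⁺, A⁻] ⟶ [A⁺ ⊗ B⁺, Ω]`: the transpose of the composite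
`[B⁺,A⁻] ⊗ A⁺ ⊗ B⁺ ⟶ A⁻ ⊗ A⁺ ⟶ Ω` (evaluation followed by `e_A`, modulo symmetry). -/
noncomputable def chuTensorLegA (A B : Chu C Ω) :
    (ihom B.pos).obj A.neg ⟶ (ihom (A.pos ⊗ B.pos)).obj Ω :=
  MonoidalClosed.curry
    ((α_ A.pos B.pos ((ihom B.pos).obj A.neg)).hom ≫
      A.pos ◁ ((ihom.ev B.pos).app A.neg) ≫ A.pair)

/-- The negative part of the tensor product: the pullback
`[A⁺,B⁻] ×_{[A⁺⊗B⁺,Ω]} [B⁺,A⁻]`. -/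
noncomputable def chuTensorNeg (A B : Chu C Ω) : C :=
  Limits.pullback (chuTensorLegB A B) (chuTensorLegA A B)

/-- The tensor product `A ⊠ B` in `Chu(C,Ω)`: `(A ⊠ B)⁺ = A⁺ ⊗ B⁺`,
`(A ⊠ B)⁻ = [A⁺,B⁻] ×_{[A⁺⊗B⁺,Ω]} [B⁺,A⁻]`, with pairing the transpose of the
common composite `(A ⊠ B)⁻ ⟶ [A⁺ ⊗ B⁺, Ω]` of the pullback. -/
noncomputable def Chu.tensorObj (A B : Chu C Ω) : Chu C Ω where
  pos := A.pos ⊗ B.pos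
  neg := chuTensorNeg A B
  pair := MonoidalClosed.uncurry
    (Limits.pullback.fst (chuTensorLegB A B) (chuTensorLegA A B) ≫ chuTensorLegB A B)

/-- The unit object `(I, Ω, λ)` of `Chu(C,Ω)`. -/
def chuUnit : Chu C Ω where
  pos := 𝟙_ C
  neg := Ω
  pair := (λ_ Ω).hom

namespace Chu

set_option linter.unusedSectionVars false

theorem hom_ext {A B : Chu C Ω} {f g : A ⟶ B} (hpos : ChuHom.pos f = ChuHom.pos g)
    (hneg : ChuHom.neg f = ChuHom.neg g) : f = g :=
  ChuHom.ext hpos hneg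

@[simp]
theorem id_pos (A : Chu C Ω) : ChuHom.pos (𝟙 A) = 𝟙 A.pos := rfl

@[simp]
theorem id_neg (A : Chu C Ω) : ChuHom.neg (𝟙 A) = 𝟙 A.neg := rfl

@[simp]
theorem comp_pos {A B E : Chu C Ω} (f : A ⟶ B) (g : B ⟶ E) :
    ChuHom.pos (f ≫ g) = ChuHom.pos f ≫ ChuHom.pos g := rfl

@[simp]
theorem comp_neg {A B E : Chu C Ω} (f : A ⟶ B) (g : B ⟶ E) :
    ChuHom.neg (f ≫ g) = ChuHom.neg g ≫ ChuHom.neg f := rfl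

/-- An isomorphism of Chu spaces from isomorphisms of both components. -/
@[simps]
def isoMk {A B : Chu C Ω} (p : A.pos ≅ B.pos) (n : B.neg ≅ A.neg)
    (h : A.pos ◁ n.hom ≫ A.pair = p.hom ▷ B.neg ≫ B.pair) : A ≅ B where
  hom := ChuHom.mk p.hom n.hom h
  inv := ChuHom.mk p.inv n.inv (by
    rw [← cancel_epi (p.hom ▷ A.neg), ← whisker_exchange_assoc, ← comp_whiskerRight_assoc,
      p.hom_inv_id, id_whiskerRight, Category.id_comp, ← cancel_epi (A.pos ◁ n.hom),
      whisker_exchange_assoc, whisker_exchange_assoc]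
    simp [h])
  hom_inv_id := by apply hom_ext <;> simp
  inv_hom_id := by apply hom_ext <;> simp

section

variable {A B E : Chu C Ω} {X Y : C}

/-- The first projection of the pullback defining the negative part of `A ⊠ B`. -/
noncomputable def negFst (A B : Chu C Ω) : chuTensorNeg A B ⟶ (ihom A.pos).obj B.neg :=
  pullback.fst _ _

/-- The second projection of the pullback defining the negative part of `A ⊠ B`. -/
noncomputable def negSnd (A B : Chu C Ω) : chuTensorNeg A B ⟶ (ihom B.pos).obj A.neg :=
  pullback.snd _ _

theorem neg_condition (A B : Chu C Ω) :
    negFst A B ≫ chuTensorLegB A B = negSnd A B ≫ chuTensorLegA A B :=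
  pullback.condition

/-- The tensor product of Chu spaces, with reducible components. -/
noncomputable abbrev tensor (A B : Chu C Ω) : Chu C Ω where
  pos := A.pos ⊗ B.pos
  neg := chuTensorNeg A B
  pair := MonoidalClosed.uncurry (negFst A B ≫ chuTensorLegB A B)

/-- The component `B⁺ ⊗ X ⟶ A⁻` of a map into the negative part of `A ⊠ B`. -/
noncomputable def fstComp (k : X ⟶ chuTensorNeg A B) : B.pos ⊗ X ⟶ A.neg :=
  MonoidalClosed.uncurry (k ≫ negSnd A B)

/-- The component `X ⊗ A⁺ ⟶ B⁻` of a map into the negative part of `A ⊠ B`. -/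
noncomputable def sndComp (k : X ⟶ chuTensorNeg A B) : X ⊗ A.pos ⟶ B.neg :=
  (β_ X A.pos).hom ≫
    MonoidalClosed.uncurry (k ≫ negFst A B)

theorem neg_ext {k l : X ⟶ chuTensorNeg A B} (h₁ : fstComp k = fstComp l)
    (h₂ : sndComp k = sndComp l) : k = l := by
  apply pullback.hom_ext
  · exact MonoidalClosed.uncurry_injective ((cancel_epi _).1 h₂)
  · exact MonoidalClosed.uncurry_injective h₁

@[simp]
theorem fstComp_comp (f : Y ⟶ X) (k : X ⟶ chuTensorNeg A B) :
    fstComp (f ≫ k) = B.pos ◁ f ≫ fstComp k := by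
  rw [fstComp, Category.assoc, MonoidalClosed.uncurry_natural_left, fstComp]

@[simp]
theorem sndComp_comp (f : Y ⟶ X) (k : X ⟶ chuTensorNeg A B) :
    sndComp (f ≫ k) = f ▷ A.pos ≫ sndComp k := by
  rw [sndComp, Category.assoc, MonoidalClosed.uncurry_natural_left, sndComp]
  simp

theorem whiskerLeft_symmetry (X Y Z : C) :
    X ◁ (β_ Y Z).hom ≫ X ◁ (β_ Z Y).hom = 𝟙 _ := by
  rw [← whiskerLeft_comp, SymmetricCategory.symmetry, whiskerLeft_id]

theorem whiskerLeft_symmetry_assoc (X Y Z : C) {W : C} (h : X ⊗ Y ⊗ Z ⟶ W) :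
    X ◁ (β_ Y Z).hom ≫ X ◁ (β_ Z Y).hom ≫ h = h := by
  rw [← Category.assoc, whiskerLeft_symmetry, Category.id_comp]

theorem whiskerRight_symmetry_assoc (X Y Z : C) {W : C} (h : (X ⊗ Y) ⊗ Z ⟶ W) :
    (β_ X Y).hom ▷ Z ≫ (β_ Y X).hom ▷ Z ≫ h = h := by
  rw [← comp_whiskerRight_assoc, SymmetricCategory.symmetry, id_whiskerRight, Category.id_comp]

/-- The cyclic rotation of a threefold tensor product. -/
def rot (P Q X : C) : P ⊗ Q ⊗ X ⟶ Q ⊗ X ⊗ P :=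
  (β_ P (Q ⊗ X)).hom ≫ (α_ Q X P).hom

instance (P Q X : C) : IsIso (rot P Q X) := by
  unfold rot
  infer_instance

theorem rot_naturality_left {P P' : C} (f : P ⟶ P') (Q X : C) {Z : C} (h : Q ⊗ X ⊗ P' ⟶ Z) :
    f ▷ (Q ⊗ X) ≫ rot P' Q X ≫ h = rot P Q X ≫ Q ◁ X ◁ f ≫ h := by
  simp only [rot, Category.assoc, BraidedCategory.braiding_naturality_left_assoc,
    tensor_whiskerLeft, Iso.inv_hom_id_assoc]

theorem rot_naturality_middle (P : C) {Q Q' : C} (f : Q ⟶ Q') (X : C) {Z : C}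
    (h : Q' ⊗ X ⊗ P ⟶ Z) :
    P ◁ f ▷ X ≫ rot P Q' X ≫ h = rot P Q X ≫ f ▷ (X ⊗ P) ≫ h := by
  simp only [rot, Category.assoc, BraidedCategory.braiding_naturality_right_assoc,
    whiskerRight_tensor, Iso.hom_inv_id_assoc]

theorem rot_naturality_right (P Q : C) {X X' : C} (f : X ⟶ X') {Z : C} (h : Q ⊗ X' ⊗ P ⟶ Z) :
    P ◁ Q ◁ f ≫ rot P Q X' ≫ h = rot P Q X ≫ Q ◁ f ▷ P ≫ h := by
  simp only [rot, Category.assoc, BraidedCategory.braiding_naturality_right_assoc,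
    whisker_assoc, Iso.inv_hom_id_assoc]

theorem rot_whiskerLeft_braiding (P Q X : C) :
    rot P Q X ≫ Q ◁ (β_ X P).hom = (α_ _ _ _).inv ≫ (β_ P Q).hom ▷ X ≫ (α_ _ _ _).hom := by
  simp [rot, whiskerLeft_symmetry]

theorem rot_whiskerLeft_braiding_rot (P Q X : C) :
    rot P Q X ≫ Q ◁ (β_ X P).hom ≫ rot Q P X = P ◁ (β_ Q X).hom := by
  rw [reassoc_of% rot_whiskerLeft_braiding, rot, BraidedCategory.braiding_tensor_right_hom]
  simp [← comp_whiskerRight_assoc]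

theorem rot_leftUnitor (P X : C) :
    rot P (𝟙_ C) X ≫ (λ_ (X ⊗ P)).hom = P ◁ (λ_ X).hom ≫ (β_ P X).hom := by
  rw [BraidedCategory.braiding_naturality_right, rot, Category.assoc]
  simp only [leftUnitor_whiskerRight]

theorem whiskerLeft_associator_inv_rot (P Q R X : C) :
    P ◁ (α_ Q R X).inv ≫ rot P (Q ⊗ R) X ≫ (α_ _ _ _).hom =
      rot P Q (R ⊗ X) ≫ Q ◁ (α_ _ _ _).hom := by
  simp [rot]

theorem braiding_comp_braiding (P Q Y : C) :
    (α_ P Q Y).hom ≫ (β_ P (Q ⊗ Y)).hom ≫ (α_ Q Y P).hom ≫ (β_ Q (Y ⊗ P)).hom =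
      (β_ (P ⊗ Q) Y).hom ≫ (α_ Y P Q).inv := by
  rw [BraidedCategory.braiding_tensor_right_hom Q Y P, Iso.hom_inv_id_assoc,
    ← BraidedCategory.braiding_naturality_right_assoc,
    BraidedCategory.braiding_tensor_right_hom P Y Q]
  simp [whiskerLeft_symmetry_assoc]

theorem rot_rot (P Q R X : C) :
    (α_ _ _ _).hom ≫ rot P Q (R ⊗ X) ≫ Q ◁ (α_ _ _ _).hom ≫ rot Q R (X ⊗ P) =
      rot (P ⊗ Q) R X ≫ R ◁ (α_ _ _ _).inv := by
  simp only [rot, Category.assoc, BraidedCategory.braiding_naturality_right_assoc]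
  rw [reassoc_of% braiding_comp_braiding P Q (R ⊗ X)]
  monoidal

theorem uncurry_comp_legA (k : X ⟶ (ihom B.pos).obj A.neg) :
    MonoidalClosed.uncurry (k ≫ chuTensorLegA A B) =
      (α_ _ _ _).hom ≫ A.pos ◁ MonoidalClosed.uncurry k ≫ A.pair := by
  simp [chuTensorLegA, MonoidalClosed.uncurry_natural_left, MonoidalClosed.uncurry_eq k]

theorem uncurry_comp_legB (k : X ⟶ (ihom A.pos).obj B.neg) :
    MonoidalClosed.uncurry (k ≫ chuTensorLegB A B) =
      (α_ _ _ _).hom ≫ rot A.pos B.pos X ≫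
        B.pos ◁ ((β_ X A.pos).hom ≫ MonoidalClosed.uncurry k) ≫ B.pair := by
  have : rot A.pos B.pos X ≫ B.pos ◁ (β_ X A.pos).hom =
      A.pos ◁ (β_ B.pos X).hom ≫ (α_ A.pos X B.pos).inv ≫ (β_ (A.pos ⊗ X) B.pos).hom := by
    simp [rot, whiskerLeft_symmetry, whiskerLeft_symmetry_assoc]
  rw [whiskerLeft_comp_assoc, reassoc_of% this, ← BraidedCategory.braiding_naturality_left_assoc]
  simp [chuTensorLegB, MonoidalClosed.uncurry_natural_left, MonoidalClosed.uncurry_eq k,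
    whiskerLeft_symmetry_assoc]
  rw [← whiskerLeft_comp_assoc A.pos (β_ B.pos X).hom, ← BraidedCategory.braiding_naturality_right,
    whiskerLeft_comp_assoc, whiskerLeft_symmetry_assoc]

theorem pair_comp (k : X ⟶ chuTensorNeg A B) :
    (A.pos ⊗ B.pos) ◁ k ≫ (tensor A B).pair =
      (α_ _ _ _).hom ≫ A.pos ◁ fstComp k ≫ A.pair := by
  rw [fstComp, ← uncurry_comp_legA, Category.assoc, ← neg_condition,
    MonoidalClosed.uncurry_natural_left]

theorem pair_comp_sndComp (k : X ⟶ chuTensorNeg A B) :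
    (A.pos ⊗ B.pos) ◁ k ≫ (tensor A B).pair =
      (α_ _ _ _).hom ≫ rot A.pos B.pos X ≫
        B.pos ◁ sndComp k ≫ B.pair := by
  rw [sndComp, ← uncurry_comp_legB, Category.assoc, MonoidalClosed.uncurry_natural_left]

theorem fstComp_pair (k : X ⟶ chuTensorNeg A B) :
    A.pos ◁ fstComp k ≫ A.pair =
      rot A.pos B.pos X ≫ B.pos ◁ sndComp k ≫ B.pair := by
  rw [← cancel_epi (α_ A.pos B.pos X).hom, ← pair_comp, pair_comp_sndComp]

/-- A map into the negative part of `A ⊠ B` from its two components. -/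
noncomputable def lift (u : B.pos ⊗ X ⟶ A.neg) (v : X ⊗ A.pos ⟶ B.neg)
    (h : A.pos ◁ u ≫ A.pair =
      rot A.pos B.pos X ≫ B.pos ◁ v ≫ B.pair) :
    X ⟶ chuTensorNeg A B :=
  pullback.lift (MonoidalClosed.curry ((β_ X A.pos).inv ≫ v)) (MonoidalClosed.curry u) (by
    apply MonoidalClosed.uncurry_injective
    rw [uncurry_comp_legA, uncurry_comp_legB]
    simp [h])

theorem lift_negFst (u : B.pos ⊗ X ⟶ A.neg) (v : X ⊗ A.pos ⟶ B.neg) (h) :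
    lift u v h ≫ negFst A B = MonoidalClosed.curry ((β_ X A.pos).inv ≫ v) :=
  pullback.lift_fst _ _ _

theorem lift_negSnd (u : B.pos ⊗ X ⟶ A.neg) (v : X ⊗ A.pos ⟶ B.neg) (h) :
    lift u v h ≫ negSnd A B = MonoidalClosed.curry u :=
  pullback.lift_snd _ _ _

@[simp]
theorem fstComp_lift (u : B.pos ⊗ X ⟶ A.neg) (v : X ⊗ A.pos ⟶ B.neg) (h) :
    fstComp (lift u v h) = u := by
  simp [fstComp, lift_negSnd]

@[simp]
theorem sndComp_lift (u : B.pos ⊗ X ⟶ A.neg) (v : X ⊗ A.pos ⟶ B.neg) (h) :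
    sndComp (lift u v h) = v := by
  simp [sndComp, lift_negFst]

end

section

variable {A A' B B' E : Chu C Ω} {X Y : C}

/-- The negative part of `f ⊠ g` postcomposed to a map into the negative part of `A' ⊠ B'`. -/
noncomputable def mapNeg (f : A ⟶ A') (g : B ⟶ B') (k : X ⟶ chuTensorNeg A' B') :
    X ⟶ chuTensorNeg A B :=
  lift (ChuHom.pos g ▷ X ≫ fstComp k ≫ ChuHom.neg f) (X ◁ ChuHom.pos f ≫ sndComp k ≫ ChuHom.neg g)
    (by
      simp only [whiskerLeft_comp, Category.assoc, ChuHom.compat f, ChuHom.compat g]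
      rw [whisker_exchange_assoc, whisker_exchange_assoc, fstComp_pair, whisker_exchange_assoc,
        rot_naturality_middle, rot_naturality_left, whisker_exchange_assoc])

@[simp]
theorem fstComp_mapNeg (f : A ⟶ A') (g : B ⟶ B') (k : X ⟶ chuTensorNeg A' B') :
    fstComp (mapNeg f g k) = ChuHom.pos g ▷ X ≫ fstComp k ≫ ChuHom.neg f :=
  fstComp_lift _ _ _

@[simp]
theorem sndComp_mapNeg (f : A ⟶ A') (g : B ⟶ B') (k : X ⟶ chuTensorNeg A' B') :
    sndComp (mapNeg f g k) = X ◁ ChuHom.pos f ≫ sndComp k ≫ ChuHom.neg g :=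
  sndComp_lift _ _ _

@[simp]
theorem comp_mapNeg (f : A ⟶ A') (g : B ⟶ B') (h : Y ⟶ X) (k : X ⟶ chuTensorNeg A' B') :
    h ≫ mapNeg f g k = mapNeg f g (h ≫ k) :=
  neg_ext (by simp [whisker_exchange_assoc]) (by simp [whisker_exchange_assoc])

/-- The tensor product of morphisms of Chu spaces. -/
@[simps]
noncomputable def tensorMap (f : A ⟶ A') (g : B ⟶ B') : tensor A B ⟶ tensor A' B' where
  pos := ChuHom.pos f ⊗ₘ ChuHom.pos g
  neg := mapNeg f g (𝟙 _)
  compat := by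
    have h := pair_comp (𝟙 (chuTensorNeg A' B'))
    rw [whiskerLeft_id, Category.id_comp] at h
    rw [pair_comp, h, fstComp_mapNeg, whiskerLeft_comp_assoc, whiskerLeft_comp_assoc,
      ChuHom.compat f, whisker_exchange_assoc]
    simp [MonoidalCategory.tensorHom_def']

theorem assoc_condition_inner (k : X ⟶ chuTensorNeg A (tensor B E)) :
    A.pos ◁ ((α_ _ _ _).inv ≫ fstComp k) ≫ A.pair =
      rot A.pos B.pos (E.pos ⊗ X) ≫ B.pos ◁ ((α_ _ _ _).hom ≫ fstComp (sndComp k)) ≫ B.pair := by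
  rw [whiskerLeft_comp_assoc, fstComp_pair, pair_comp, whiskerLeft_comp_assoc,
    ← Category.assoc (rot A.pos B.pos _), ← whiskerLeft_associator_inv_rot]
  simp only [Category.assoc]

theorem assoc_condition_outer (k : X ⟶ chuTensorNeg A (tensor B E)) :
    (tensor A B).pos ◁ lift ((α_ _ _ _).inv ≫ fstComp k) ((α_ _ _ _).hom ≫ fstComp (sndComp k))
      (assoc_condition_inner k) ≫ (tensor A B).pair =
      rot (tensor A B).pos E.pos X ≫ E.pos ◁ ((α_ _ _ _).inv ≫ sndComp (sndComp k)) ≫ E.pair := by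
  rw [pair_comp, fstComp_lift, assoc_condition_inner, whiskerLeft_comp_assoc, fstComp_pair,
    whiskerLeft_comp_assoc, ← Category.assoc (rot (A.pos ⊗ B.pos) _ _), ← rot_rot]
  simp only [Category.assoc]

/-- The negative part of the associator, postcomposed to a map. -/
noncomputable def assocNeg (k : X ⟶ chuTensorNeg A (tensor B E)) :
    X ⟶ chuTensorNeg (tensor A B) E :=
  lift (lift ((α_ _ _ _).inv ≫ fstComp k) ((α_ _ _ _).hom ≫ fstComp (sndComp k))
    (assoc_condition_inner k)) ((α_ _ _ _).inv ≫ sndComp (sndComp k)) (assoc_condition_outer k)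

theorem assocInv_condition_inner (k : X ⟶ chuTensorNeg (tensor A B) E) :
    B.pos ◁ ((α_ _ _ _).inv ≫ sndComp (fstComp k)) ≫ B.pair =
      rot B.pos E.pos (X ⊗ A.pos) ≫ E.pos ◁ ((α_ _ _ _).hom ≫ sndComp k) ≫ E.pair := by
  have h := fstComp_pair k
  rw [pair_comp, fstComp_pair] at h
  rw [← cancel_epi ((α_ A.pos B.pos (E.pos ⊗ X)).hom ≫ rot A.pos B.pos (E.pos ⊗ X) ≫
    B.pos ◁ (α_ _ _ _).hom)]
  simp only [Category.assoc]
  rw [reassoc_of% rot_rot A.pos B.pos E.pos X, ← whiskerLeft_comp_assoc, ← whiskerLeft_comp_assoc,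
    Iso.hom_inv_id_assoc, Iso.inv_hom_id_assoc]
  exact h

theorem assocInv_condition_outer (k : X ⟶ chuTensorNeg (tensor A B) E) :
    A.pos ◁ ((α_ _ _ _).hom ≫ fstComp (fstComp k)) ≫ A.pair =
      rot A.pos (tensor B E).pos X ≫ (tensor B E).pos ◁ lift ((α_ _ _ _).inv ≫ sndComp (fstComp k))
        ((α_ _ _ _).hom ≫ sndComp k) (assocInv_condition_inner k) ≫ (tensor B E).pair := by
  rw [pair_comp, fstComp_lift, whiskerLeft_comp_assoc, fstComp_pair,
    ← cancel_epi (A.pos ◁ (α_ B.pos E.pos X).inv),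
    reassoc_of% whiskerLeft_associator_inv_rot A.pos B.pos E.pos X,
    ← whiskerLeft_comp_assoc, ← whiskerLeft_comp_assoc, Iso.hom_inv_id_assoc, Iso.inv_hom_id,
    whiskerLeft_id, Category.id_comp]

/-- The negative part of the inverse of the associator, postcomposed to a map. -/
noncomputable def assocNegInv (k : X ⟶ chuTensorNeg (tensor A B) E) :
    X ⟶ chuTensorNeg A (tensor B E) :=
  lift ((α_ _ _ _).hom ≫ fstComp (fstComp k))
    (lift ((α_ _ _ _).inv ≫ sndComp (fstComp k)) ((α_ _ _ _).hom ≫ sndComp k)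
      (assocInv_condition_inner k)) (assocInv_condition_outer k)

@[simp]
theorem fstComp_fstComp_assocNeg (k : X ⟶ chuTensorNeg A (tensor B E)) :
    fstComp (fstComp (assocNeg k)) = (α_ _ _ _).inv ≫ fstComp k := by
  simp [assocNeg]

@[simp]
theorem sndComp_fstComp_assocNeg (k : X ⟶ chuTensorNeg A (tensor B E)) :
    sndComp (fstComp (assocNeg k)) = (α_ _ _ _).hom ≫ fstComp (sndComp k) := by
  simp [assocNeg]

@[simp]
theorem sndComp_assocNeg (k : X ⟶ chuTensorNeg A (tensor B E)) :
    sndComp (assocNeg k) = (α_ _ _ _).inv ≫ sndComp (sndComp k) := by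
  simp [assocNeg]

@[simp]
theorem fstComp_assocNegInv (k : X ⟶ chuTensorNeg (tensor A B) E) :
    fstComp (assocNegInv k) = (α_ _ _ _).hom ≫ fstComp (fstComp k) := by
  simp [assocNegInv]

@[simp]
theorem fstComp_sndComp_assocNegInv (k : X ⟶ chuTensorNeg (tensor A B) E) :
    fstComp (sndComp (assocNegInv k)) = (α_ _ _ _).inv ≫ sndComp (fstComp k) := by
  simp [assocNegInv]

@[simp]
theorem sndComp_sndComp_assocNegInv (k : X ⟶ chuTensorNeg (tensor A B) E) :
    sndComp (sndComp (assocNegInv k)) = (α_ _ _ _).hom ≫ sndComp k := by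
  simp [assocNegInv]

@[simp]
theorem comp_assocNeg (h : Y ⟶ X) (k : X ⟶ chuTensorNeg A (tensor B E)) :
    h ≫ assocNeg k = assocNeg (h ≫ k) :=
  neg_ext (neg_ext (by simp) (by simp)) (by simp)

@[simp]
theorem comp_assocNegInv (h : Y ⟶ X) (k : X ⟶ chuTensorNeg (tensor A B) E) :
    h ≫ assocNegInv k = assocNegInv (h ≫ k) :=
  neg_ext (by simp) (neg_ext (by simp) (by simp))

/-- The associator. -/
noncomputable def assocIso (A B E : Chu C Ω) :
    tensor (tensor A B) E ≅ tensor A (tensor B E) :=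
  isoMk (α_ _ _ _)
    { hom := assocNeg (𝟙 _)
      inv := assocNegInv (𝟙 _)
      hom_inv_id := neg_ext (by simp) (neg_ext (by simp) (by simp))
      inv_hom_id := neg_ext (neg_ext (by simp) (by simp)) (by simp) }
    (by
      have h := pair_comp (𝟙 (chuTensorNeg A (tensor B E)))
      rw [whiskerLeft_id, Category.id_comp] at h
      rw [pair_comp, pair_comp, fstComp_fstComp_assocNeg, h]
      simp)

@[simp]
theorem assocIso_hom_pos (A B E : Chu C Ω) :
    ChuHom.pos (assocIso A B E).hom = (α_ A.pos B.pos E.pos).hom := rfl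

@[simp]
theorem assocIso_hom_neg (A B E : Chu C Ω) :
    ChuHom.neg (assocIso A B E).hom = assocNeg (𝟙 (chuTensorNeg A (tensor B E))) := rfl

@[simp]
theorem assocIso_inv_pos (A B E : Chu C Ω) :
    ChuHom.pos (assocIso A B E).inv = (α_ A.pos B.pos E.pos).inv := rfl

@[simp]
theorem assocIso_inv_neg (A B E : Chu C Ω) :
    ChuHom.neg (assocIso A B E).inv = assocNegInv (𝟙 (chuTensorNeg (tensor A B) E)) := rfl

/-- The unit Chu space, with reducible components. -/
abbrev unit : Chu C Ω where
  pos := 𝟙_ C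
  neg := Ω
  pair := (λ_ Ω).hom

/-- The left unitor. -/
noncomputable def leftUnitorIso (A : Chu C Ω) : tensor unit A ≅ A :=
  isoMk (λ_ _)
    { hom := lift A.pair (ρ_ _).hom (by simp [rot])
      inv := (ρ_ _).inv ≫ sndComp (𝟙 (chuTensorNeg unit A))
      hom_inv_id := by
        have h := sndComp_comp (lift (A := unit) A.pair (ρ_ _).hom (by simp [rot])) (𝟙 _)
        rw [Category.comp_id, sndComp_lift] at h
        rw [rightUnitor_inv_naturality_assoc, ← h, Iso.inv_hom_id]
      inv_hom_id := by
        have h := fstComp_pair (𝟙 (chuTensorNeg unit A))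
        apply neg_ext
        · simp [rot] at h ⊢
          simp [← h]
        · simp }
    (by
      rw [pair_comp]
      simp)

@[simp]
theorem leftUnitorIso_hom_pos (A : Chu C Ω) :
    ChuHom.pos (leftUnitorIso A).hom = (λ_ A.pos).hom := rfl

@[simp]
theorem leftUnitorIso_hom_neg (A : Chu C Ω) :
    ChuHom.neg (leftUnitorIso A).hom = lift (A := unit) A.pair (ρ_ A.neg).hom (by simp [rot]) := rfl

theorem rightUnitor_condition (A : Chu C Ω) :
    A.pos ◁ (λ_ A.neg).hom ≫ A.pair =
      rot A.pos (unit : Chu C Ω).pos A.neg ≫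
        (unit : Chu C Ω).pos ◁ ((β_ A.neg A.pos).hom ≫ A.pair) ≫ (unit : Chu C Ω).pair := by
  rw [leftUnitor_naturality, reassoc_of% rot_leftUnitor A.pos A.neg,
    SymmetricCategory.symmetry_assoc]

/-- The right unitor. -/
noncomputable def rightUnitorIso (A : Chu C Ω) : tensor A unit ≅ A :=
  isoMk (ρ_ _)
    { hom := lift (λ_ _).hom ((β_ _ _).hom ≫ A.pair) (rightUnitor_condition A)
      inv := (λ_ _).inv ≫ fstComp (𝟙 (chuTensorNeg A unit))
      hom_inv_id := by
        have h := fstComp_comp (lift (B := unit) (λ_ _).hom ((β_ _ A.pos).hom ≫ A.pair)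
          (rightUnitor_condition A)) (𝟙 _)
        rw [Category.comp_id, fstComp_lift] at h
        rw [leftUnitor_inv_naturality_assoc, ← h, Iso.inv_hom_id]
      inv_hom_id := by
        have h := fstComp_pair (𝟙 (chuTensorNeg A unit))
        apply neg_ext
        · simp
        · rw [leftUnitor_naturality, reassoc_of% rot_leftUnitor A.pos] at h
          rw [sndComp_comp, sndComp_lift, comp_whiskerRight_assoc,
            BraidedCategory.braiding_naturality_left_assoc, h,
            BraidedCategory.braiding_naturality_left_assoc, whiskerLeft_inv_hom_assoc]
          rw [SymmetricCategory.symmetry_assoc] }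
    (by
      rw [pair_comp]
      simp)

@[simp]
theorem rightUnitorIso_hom_pos (A : Chu C Ω) :
    ChuHom.pos (rightUnitorIso A).hom = (ρ_ A.pos).hom := rfl

@[simp]
theorem rightUnitorIso_hom_neg (A : Chu C Ω) :
    ChuHom.neg (rightUnitorIso A).hom = lift (B := unit) (λ_ A.neg).hom ((β_ A.neg A.pos).hom ≫ A.pair)
      (rightUnitor_condition A) := rfl

/-- The negative part of the symmetry, postcomposed to a map. -/
noncomputable def swapNeg (k : X ⟶ chuTensorNeg A B) : X ⟶ chuTensorNeg B A :=
  lift ((β_ _ _).hom ≫ sndComp k) ((β_ _ _).hom ≫ fstComp k) (by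
    rw [whiskerLeft_comp_assoc B.pos, whiskerLeft_comp_assoc A.pos, fstComp_pair,
      reassoc_of% rot_whiskerLeft_braiding_rot])

@[simp]
theorem fstComp_swapNeg (k : X ⟶ chuTensorNeg A B) :
    fstComp (swapNeg k) = (β_ _ _).hom ≫ sndComp k :=
  fstComp_lift _ _ _

@[simp]
theorem sndComp_swapNeg (k : X ⟶ chuTensorNeg A B) :
    sndComp (swapNeg k) = (β_ _ _).hom ≫ fstComp k :=
  sndComp_lift _ _ _

@[simp]
theorem comp_swapNeg (h : Y ⟶ X) (k : X ⟶ chuTensorNeg A B) :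
    h ≫ swapNeg k = swapNeg (h ≫ k) :=
  neg_ext (by simp) (by simp)

/-- The symmetry. -/
noncomputable def swapIso (A B : Chu C Ω) : tensor A B ≅ tensor B A :=
  isoMk (β_ _ _)
    { hom := swapNeg (𝟙 _)
      inv := swapNeg (𝟙 _)
      hom_inv_id := neg_ext (by simp) (by simp)
      inv_hom_id := neg_ext (by simp) (by simp) }
    (by
      have h := pair_comp (𝟙 (chuTensorNeg B A))
      have h' := fstComp_pair (𝟙 (chuTensorNeg B A))
      rw [whiskerLeft_id, Category.id_comp, h'] at h
      rw [pair_comp, h]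
      simp [rot, ← comp_whiskerRight_assoc])

@[simp]
theorem swapIso_hom_pos (A B : Chu C Ω) :
    ChuHom.pos (swapIso A B).hom = (β_ A.pos B.pos).hom := rfl

@[simp]
theorem swapIso_hom_neg (A B : Chu C Ω) :
    ChuHom.neg (swapIso A B).hom = swapNeg (𝟙 (chuTensorNeg B A)) := rfl

end

theorem tensorMap_id (A B : Chu C Ω) : tensorMap (𝟙 A) (𝟙 B) = 𝟙 (tensor A B) :=
  hom_ext (by simp) (neg_ext (by simp) (by simp))

theorem tensorMap_comp {A A' A'' B B' B'' : Chu C Ω} (f : A ⟶ A') (g : B ⟶ B')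
    (f' : A' ⟶ A'') (g' : B' ⟶ B'') :
    tensorMap f g ≫ tensorMap f' g' = tensorMap (f ≫ f') (g ≫ g') :=
  hom_ext (by simp) (neg_ext (by simp) (by simp))

theorem assoc_naturality {A A' B B' E E' : Chu C Ω} (f : A ⟶ A') (g : B ⟶ B') (h : E ⟶ E') :
    tensorMap (tensorMap f g) h ≫ (assocIso A' B' E').hom =
      (assocIso A B E).hom ≫ tensorMap f (tensorMap g h) := by
  refine hom_ext (by simp) (neg_ext (neg_ext ?_ ?_) ?_)
  · simp [MonoidalCategory.tensorHom_def]
  · have w := whisker_exchange (ChuHom.pos h ▷ chuTensorNeg A' (tensor B' E')) (ChuHom.pos f)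
    simp only [tensor_whiskerLeft, Category.assoc] at w
    simp [reassoc_of% w]
  · simp [MonoidalCategory.tensorHom_def']

theorem leftUnitorIso_naturality {A B : Chu C Ω} (f : A ⟶ B) :
    tensorMap (𝟙 unit) f ≫ (leftUnitorIso B).hom = (leftUnitorIso A).hom ≫ f :=
  hom_ext (by simp) (neg_ext (by simpa using (ChuHom.compat f).symm) (by simp))

theorem rightUnitorIso_naturality {A B : Chu C Ω} (f : A ⟶ B) :
    tensorMap f (𝟙 unit) ≫ (rightUnitorIso B).hom = (rightUnitorIso A).hom ≫ f :=
  hom_ext (by simp) (neg_ext (by simp) (by simpa using (ChuHom.compat f).symm))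

theorem pentagon (A B E F : Chu C Ω) :
    tensorMap (assocIso A B E).hom (𝟙 F) ≫ (assocIso A (tensor B E) F).hom ≫
        tensorMap (𝟙 A) (assocIso B E F).hom =
      (assocIso (tensor A B) E F).hom ≫ (assocIso A B (tensor E F)).hom :=
  hom_ext (by simp)
    (neg_ext (neg_ext (neg_ext (by simp) (by simp)) (by simp)) (by simp))

theorem triangle (A B : Chu C Ω) :
    (assocIso A unit B).hom ≫ tensorMap (𝟙 A) (leftUnitorIso B).hom =
      tensorMap (rightUnitorIso A).hom (𝟙 B) :=
  hom_ext (by simp) (neg_ext (neg_ext (by simp) (by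
    simp [fstComp_pair, rot, whiskerRight_symmetry_assoc, whiskerLeft_symmetry_assoc])) (by simp))

theorem swap_naturality {A A' B B' : Chu C Ω} (f : A ⟶ A') (g : B ⟶ B') :
    tensorMap f g ≫ (swapIso A' B').hom = (swapIso A B).hom ≫ tensorMap g f :=
  hom_ext (by simp) (neg_ext (by simp) (by simp))

theorem hexagon (A B E : Chu C Ω) :
    (assocIso A B E).hom ≫ (swapIso A (tensor B E)).hom ≫ (assocIso B E A).hom =
      tensorMap (swapIso A B).hom (𝟙 E) ≫ (assocIso B A E).hom ≫
        tensorMap (𝟙 B) (swapIso A E).hom := by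
  refine hom_ext (by simp) (neg_ext (neg_ext ?_ ?_) ?_)
  · simp [BraidedCategory.yang_baxter_assoc, whiskerLeft_symmetry_assoc]
  · simp [whiskerRight_symmetry_assoc]
  · simp [whiskerLeft_symmetry_assoc]

theorem swap_swap (A B : Chu C Ω) : (swapIso A B).hom ≫ (swapIso B A).hom = 𝟙 (tensor A B) :=
  hom_ext (by simp) (neg_ext (by simp) (by simp))

theorem hexagon_reverse (A B E : Chu C Ω) :
    (assocIso A B E).inv ≫ (swapIso (tensor A B) E).hom ≫ (assocIso E A B).inv =
      tensorMap (𝟙 A) (swapIso B E).hom ≫ (assocIso A E B).inv ≫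
        tensorMap (swapIso A E).hom (𝟙 B) := by
  refine hom_ext (by simp) (neg_ext ?_ (neg_ext ?_ ?_))
  · simp [whiskerRight_symmetry_assoc]
  · simp [whiskerLeft_symmetry_assoc]
  · simp [BraidedCategory.yang_baxter_assoc, whiskerLeft_symmetry_assoc]

/-- The symmetric monoidal structure on the Chu category. -/
noncomputable abbrev monoidal : MonoidalCategory (Chu C Ω) :=
  letI : MonoidalCategoryStruct (Chu C Ω) :=
    { tensorObj := tensor
      tensorUnit := unit
      tensorHom := tensorMap
      whiskerLeft A _ _ f := tensorMap (𝟙 A) f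
      whiskerRight f B := tensorMap f (𝟙 B)
      associator := assocIso
      leftUnitor := leftUnitorIso
      rightUnitor := rightUnitorIso }
  MonoidalCategory.ofTensorHom
    (id_tensorHom_id := tensorMap_id)
    (id_tensorHom := fun _ _ _ _ => rfl)
    (tensorHom_id := fun _ _ => rfl)
    (tensorHom_comp_tensorHom := tensorMap_comp)
    (associator_naturality := assoc_naturality)
    (leftUnitor_naturality := leftUnitorIso_naturality)
    (rightUnitor_naturality := rightUnitorIso_naturality)
    (pentagon := pentagon)
    (triangle := triangle)

/-- The symmetry makes `Chu.monoidal` symmetric. -/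
noncomputable abbrev symmetric : @SymmetricCategory (Chu C Ω) _ monoidal :=
  letI : MonoidalCategory (Chu C Ω) := monoidal
  { braiding := swapIso
    braiding_naturality_right := fun A _ _ f => swap_naturality (𝟙 A) f
    braiding_naturality_left := fun f B => swap_naturality f (𝟙 B)
    hexagon_forward := hexagon
    hexagon_reverse := hexagon_reverse
    symmetry := swap_swap }

end Chu

/-- `Chu(C,Ω)` admits a symmetric monoidal structure whose tensor
product on objects is `A ⊠ B` (with `(A ⊠ B)⁺ = A⁺ ⊗ B⁺` and `(A ⊠ B)⁻` the pullback of
`[A⁺,B⁻] ⟶ [A⁺ ⊗ B⁺, Ω] ⟵ [B⁺,A⁻]`), and whose unit object is `(I, Ω, λ)`. -/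
theorem chu_symmetric_monoidal
    (C : Type u) [Category.{v} C] [MonoidalCategory C] [SymmetricCategory C] (Ω : C)
    [MonoidalClosed C] [Limits.HasPullbacks C] :
    ∃ (M : MonoidalCategory (Chu C Ω)) (_ : @SymmetricCategory (Chu C Ω) _ M),
      (∀ A B : Chu C Ω,
        @MonoidalCategoryStruct.tensorObj (Chu C Ω) _ M.toMonoidalCategoryStruct A B
          = Chu.tensorObj A B) ∧
      @MonoidalCategoryStruct.tensorUnit (Chu C Ω) _ M.toMonoidalCategoryStruct
          = chuUnit := by
  exact ⟨Chu.monoidal, Chu.symmetric, fun _ _ => rfl, rfl⟩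
end

section
/- Let X be a category, let θ be a clique on a list (φ₁,…,φ_m) of objects of X and η a clique on a list (ξ₁,…,ξ_n), and suppose φ_{j₀} = ξ_{k₀} for some indices j₀, k₀. Then the family of isomorphisms on the concatenated list consisting of (φ_j)_{j ≠ j₀} followed by (ξ_k)_{k ≠ k₀}, defined by θ between two φ's, by η between two ξ's, and between φ_j and ξ_k by the composite φ_j ≅ φ_{j₀} = ξ_{k₀} ≅ ξ_k (i.e. η_{k₀ k} composed with θ_{j j₀} across the equality φ_{j₀} = ξ_{k₀}), is again a clique: it satisfies the identity and cocycle conditions. -/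
open CategoryTheory

universe v u

/-- A clique on a (finite) list `φ` of objects of a category `X`: a family of
isomorphisms `θ i j : φ i ≅ φ j` such that `θ i i = 𝟙` and `θ j k ∘ θ i j = θ i k`. -/
structure Clique {X : Type u} [Category.{v} X] {ι : Type*} (φ : ι → X) where
  iso : ∀ i j : ι, φ i ≅ φ j
  iso_refl : ∀ i : ι, iso i i = Iso.refl (φ i)
  iso_trans : ∀ i j k : ι, iso i j ≪≫ iso j k = iso i k

variable {X : Type u} [Category.{v} X]

/-- The glued family of objects: the list `(φ_j)_{j ≠ j₀}` followed by `(ξ_k)_{k ≠ k₀}`. -/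
def gluedFamily {m n : ℕ} (φ : Fin m → X) (ξ : Fin n → X) (j₀ : Fin m) (k₀ : Fin n) :
    ({j : Fin m // j ≠ j₀} ⊕ {k : Fin n // k ≠ k₀}) → X
  | Sum.inl j => φ j.1
  | Sum.inr k => ξ k.1

/-- The glued family of isomorphisms: `θ` between two `φ`'s, `η` between two `ξ`'s, and
between `φ_j` and `ξ_k` the composite `φ_j ≅ φ_{j₀} = ξ_{k₀} ≅ ξ_k` (and its inverse
construction in the other direction). -/
def gluedIso {m n : ℕ} {φ : Fin m → X} {ξ : Fin n → X} {j₀ : Fin m} {k₀ : Fin n}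
    (θ : Clique φ) (η : Clique ξ) (h : φ j₀ = ξ k₀) :
    ∀ p q, gluedFamily φ ξ j₀ k₀ p ≅ gluedFamily φ ξ j₀ k₀ q
  | Sum.inl j, Sum.inl j' => θ.iso j.1 j'.1
  | Sum.inr k, Sum.inr k' => η.iso k.1 k'.1
  | Sum.inl j, Sum.inr k => θ.iso j.1 j₀ ≪≫ eqToIso h ≪≫ η.iso k₀ k.1
  | Sum.inr k, Sum.inl j => η.iso k.1 k₀ ≪≫ eqToIso h.symm ≪≫ θ.iso j₀ j.1

namespace Clique

variable {ι : Type*} {φ : ι → X}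

theorem hom_comp_hom (θ : Clique φ) (i j k : ι) :
    (θ.iso i j).hom ≫ (θ.iso j k).hom = (θ.iso i k).hom :=
  congrArg Iso.hom (θ.iso_trans i j k)

theorem hom_comp_hom_comp (θ : Clique φ) (i j k : ι) {Z : X} (f : φ k ⟶ Z) :
    (θ.iso i j).hom ≫ (θ.iso j k).hom ≫ f = (θ.iso i k).hom ≫ f := by
  rw [← Category.assoc, hom_comp_hom]

theorem hom_self (θ : Clique φ) (i : ι) : (θ.iso i i).hom = 𝟙 (φ i) :=
  congrArg Iso.hom (θ.iso_refl i)

end Clique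

/-- Given cliques `θ` on `(φ₁, …, φ_m)` and `η` on `(ξ₁, …, ξ_n)` with
`φ_{j₀} = ξ_{k₀}`, the glued family of isomorphisms on the concatenated list
`(φ_j)_{j ≠ j₀}, (ξ_k)_{k ≠ k₀}` is again a clique: it satisfies the identity and
cocycle conditions. -/
theorem gluedIso_is_clique {m n : ℕ} {φ : Fin m → X} {ξ : Fin n → X} {j₀ : Fin m}
    {k₀ : Fin n} (θ : Clique φ) (η : Clique ξ) (h : φ j₀ = ξ k₀) :
    (∀ p, gluedIso θ η h p p = Iso.refl (gluedFamily φ ξ j₀ k₀ p)) ∧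
    (∀ p q r, gluedIso θ η h p q ≪≫ gluedIso θ η h q r = gluedIso θ η h p r) := by
  refine ⟨?_, ?_⟩
  · rintro (j | k)
    · exact θ.iso_refl j
    · exact η.iso_refl k
  · rintro (_ | _) (_ | _) (_ | _) <;> ext <;>
      simp [gluedIso, gluedFamily, Clique.hom_comp_hom, Clique.hom_comp_hom_comp,
        Clique.hom_self]
end
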